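/- Let H(a,b,c) be the Gyroid Harper Hamiltonian. For a,b,c ∈ [0,2π), the characteristic polynomial det(z·I − H(a,b,c)) has a repeated root (equivalently, H(a,b,c) has an eigenvalue of multiplicity at least 2) if and only if (a,b,c) is one of the four points (0,0,0), (π,π,π), (π/2,π/2,π/2), (3π/2,3π/2,3π/2). -/

import Mathlib

open Real Polynomial Matrix

/-- The Gyroid Harper Hamiltonian. -/
noncomputable def GyroidH (a b c : ℝ) : Matrix (Fin 4) (Fin 4) ℂ :=
  !![0, 1, 1, 1;
     1, 0, Complex.exp (Complex.I * a), Complex.exp (-(Complex.I * b));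
     1, Complex.exp (-(Complex.I * a)), 0, Complex.exp (Complex.I * c);
     1, Complex.exp (Complex.I * b), Complex.exp (-(Complex.I * c)), 0]

theorem exists_adjugate_eq_zero_of_sq_dvd_charpoly {n : Type*} [Fintype n]
    [DecidableEq n] {A : Matrix n n ℂ} (hA : A.IsHermitian) {z : ℂ}
    (hz : (X - C z) ^ 2 ∣ A.charpoly) :
    ∃ x : ℝ, (x : ℂ) = z ∧ adjugate (scalar n z - A) = 0 := by
  have hcount : 2 ≤ A.charpoly.roots.count z := by
    rw [count_roots]
    exact (le_rootMultiplicity_iff A.charpoly_monic.ne_zero).2 hz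
  rw [hA.roots_charpoly_eq_eigenvalues, Multiset.count_map] at hcount
  obtain ⟨i, hi, j, hj, hij⟩ := Finset.one_lt_card.1
    (show 1 < (Finset.univ.filter fun i ↦ z = (RCLike.ofReal ∘ hA.eigenvalues) i).card from hcount)
  simp only [Finset.mem_filter, Finset.mem_univ, true_and, Function.comp_apply] at hi hj
  refine ⟨hA.eigenvalues i, hi.symm, ?_⟩
  set U : Matrix n n ℂ := hA.eigenvectorUnitary.1
  have hUU : U * star U = 1 := Unitary.mul_star_self_of_mem hA.eigenvectorUnitary.2
  have hdiag : scalar n z - A =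
      U * diagonal (fun k ↦ z - (hA.eigenvalues k : ℂ)) * star U := by
    have hsub : diagonal (fun k ↦ z - (hA.eigenvalues k : ℂ)) =
        scalar n z - diagonal (RCLike.ofReal ∘ hA.eigenvalues) := by
      rw [scalar_apply, diagonal_sub]
      rfl
    conv_lhs => rw [hA.spectral_theorem, Unitary.conjStarAlgAut_apply]
    rw [hsub, mul_sub, sub_mul, ← (scalar_commute z (Commute.all z) U).eq, mul_assoc _ U, hUU,
      mul_one]
  have hzero : (diagonal fun k ↦ ∏ l ∈ Finset.univ.erase k, (z - (hA.eigenvalues l : ℂ))) = 0 := by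
    rw [← diagonal_zero]
    congr 1
    funext k
    by_cases hk : k = i
    · exact Finset.prod_eq_zero (i := j) (by simp [hk, hij.symm]) (sub_eq_zero.2 hj)
    · exact Finset.prod_eq_zero (i := i) (by simp [Ne.symm hk]) (sub_eq_zero.2 hi)
  rw [hdiag, adjugate_mul_distrib, adjugate_mul_distrib, adjugate_diagonal, hzero, zero_mul,
    mul_zero]

theorem Real.eq_of_cos_eq_of_sin_eq {x y : ℝ} (hx : x ∈ Set.Ico 0 (2 * π))
    (hy : y ∈ Set.Ico 0 (2 * π)) (hcos : cos x = cos y) (hsin : sin x = sin y) : x = y := by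
  refine sub_eq_zero.1 ((cos_eq_one_iff_of_lt_of_lt ?_ ?_).1 ?_)
  · linarith [hx.1, hy.2]
  · linarith [hx.2, hy.1]
  · rw [cos_sub, hcos, hsin]
    linarith [cos_sq_add_sin_sq y]

theorem isHermitian_gyroidH (a b c : ℝ) : (GyroidH a b c).IsHermitian := by
  ext i j
  fin_cases i <;> fin_cases j <;> simp [GyroidH, conjTranspose_apply, ← Complex.exp_conj]

theorem charpoly_gyroid_of_phases {p p' q q' r r' : ℂ} (hp : p * p' = 1) (hq : q * q' = 1)
    (hr : r * r' = 1) :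
    !![0, 1, 1, 1; 1, 0, p, q'; 1, p', 0, r; 1, q, r', 0].charpoly =
      X ^ 4 - 6 * X ^ 2 - C (p + p' + q + q' + r + r' + p * q * r + p' * q' * r') * X
        + C (3 - (p * q + p' * q' + q * r + q' * r' + p * r + p' * r')) := by
  have hp' : (C p * C p' : ℂ[X]) = 1 := by rw [← C_mul, hp, C_1]
  have hq' : (C q * C q' : ℂ[X]) = 1 := by rw [← C_mul, hq, C_1]
  have hr' : (C r * C r' : ℂ[X]) = 1 := by rw [← C_mul, hr, C_1]
  have h3 : (C 3 : ℂ[X]) = 3 := rfl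
  simp [charpoly, charmatrix, det_succ_row_zero, Fin.sum_univ_succ, Fin.succAbove,
    diagonal_apply, C_sub, C_add, C_mul]
  linear_combination (1 - X ^ 2) * (hp' + hq' + hr') - h3

theorem charpoly_gyroidH_diag {t : ℝ} {p : ℂ} (ht : Complex.exp (Complex.I * t) = p) :
    (GyroidH t t t).charpoly = X ^ 4 - 6 * X ^ 2 - C (3 * (p + p⁻¹) + p ^ 3 + p⁻¹ ^ 3) * X
      + C (3 - 3 * (p ^ 2 + p⁻¹ ^ 2)) := by
  have hp : p * p⁻¹ = 1 := mul_inv_cancel₀ (ht ▸ Complex.exp_ne_zero _)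
  rw [GyroidH, Complex.exp_neg, ht, charpoly_gyroid_of_phases hp hp hp]
  ring_nf

theorem sq_dvd_charpoly_gyroidH_diag {t : ℝ} {p : ℂ} (ht : Complex.exp (Complex.I * t) = p)
    (hp : p ^ 2 = -1) : (X - C (√3 : ℂ)) ^ 2 ∣ (GyroidH t t t).charpoly := by
  have hinv : p⁻¹ = -p := inv_eq_of_mul_eq_one_right (by linear_combination -hp)
  have h3 : (C (√3 : ℂ) ^ 2 : ℂ[X]) = 3 := by
    rw [← C_pow, ← Complex.ofReal_pow, sq_sqrt (by norm_num)]
    rfl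
  have h9 : (C 9 : ℂ[X]) = 9 := rfl
  refine ⟨(X + C (√3 : ℂ)) ^ 2, ?_⟩
  rw [charpoly_gyroidH_diag ht, hinv,
    show 3 * (p + -p) + p ^ 3 + (-p) ^ 3 = 0 by ring,
    show 3 - 3 * (p ^ 2 + (-p) ^ 2) = 9 by linear_combination -6 * hp, C_0, h9]
  linear_combination (2 * X ^ 2 - 3 - C (√3 : ℂ) ^ 2) * h3

theorem relations_of_adjugate_gyroidH_eq_zero {a b c x : ℝ}
    (h : adjugate (scalar (Fin 4) (x : ℂ) - GyroidH a b c) = 0) :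
    (x ^ 3 - 3 * x = 2 * cos a ∧ x ^ 3 - 3 * x = 2 * cos b ∧ x ^ 3 - 3 * x = 2 * cos c ∧
      x ^ 3 - 3 * x = 2 * cos (a + b + c)) ∧
    x ^ 2 + x * (cos a + cos b) + cos (b + c) + cos (a + c) = 1 ∧
    x ^ 2 + x * (cos a + cos c) + cos (b + c) + cos (a + b) = 1 ∧
    x ^ 2 + x * (cos b + cos c) + cos (a + b) + cos (a + c) = 1 := by
  have ha := cos_sq_add_sin_sq a
  have hb := cos_sq_add_sin_sq b
  have hc := cos_sq_add_sin_sq c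
  have minor (i j : Fin 4) : ((scalar (Fin 4) (x : ℂ) - GyroidH a b c).submatrix
      j.succAbove i.succAbove).det.re = 0 := by
    have hij := congr_fun₂ h i j
    rw [adjugate_fin_succ_eq_det_submatrix] at hij
    rw [(mul_eq_zero.1 hij).resolve_left (pow_ne_zero _ (by norm_num)), Complex.zero_re]
  have h33 := minor 3 3
  have h22 := minor 2 2
  have h11 := minor 1 1
  have h00 := minor 0 0
  have h01 := minor 0 1
  have h02 := minor 0 2
  have h03 := minor 0 3
  simp [det_fin_three, GyroidH, Fin.succAbove, mul_comm Complex.I, Complex.exp_mul_I, ← neg_mul]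
    at h33 h22 h11 h00 h01 h02 h03
  simp only [Complex.cos_ofReal_re, Complex.sin_ofReal_re] at h33 h22 h11 h00 h01 h02 h03
  simp only [cos_add, sin_add]
  refine ⟨⟨?_, ?_, ?_, ?_⟩, ?_, ?_, ?_⟩
  · linear_combination h33 + x * ha
  · linear_combination h22 + x * hb
  · linear_combination h11 + x * hc
  · linear_combination h00 + x * (ha + hb + hc)
  · linear_combination -h01 + hc
  · linear_combination h02 + hb
  · linear_combination -h03 + ha

theorem cos_sin_cases_of_adjugate_gyroidH_eq_zero {a b c x : ℝ}
    (h : adjugate (scalar (Fin 4) (x : ℂ) - GyroidH a b c) = 0) :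
    cos b = cos a ∧ cos c = cos a ∧ sin b = sin a ∧ sin c = sin a ∧
      (cos a = 0 ∧ (sin a = 1 ∨ sin a = -1) ∨ sin a = 0 ∧ (cos a = 1 ∨ cos a = -1)) := by
  obtain ⟨⟨h₁, h₂, h₃, h₄⟩, h₅, h₆, h₇⟩ := relations_of_adjugate_gyroidH_eq_zero h
  have hb : cos b = cos a := by linarith
  have hc : cos c = cos a := by linarith
  have hs := sin_sq_add_cos_sq a
  have hsb : sin b = sin a ∨ sin b = -sin a :=
    sq_eq_sq_iff_eq_or_eq_neg.1 (by rw [sin_sq, sin_sq, hb])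
  have hsc : sin c = sin a ∨ sin c = -sin a :=
    sq_eq_sq_iff_eq_or_eq_neg.1 (by rw [sin_sq, sin_sq, hc])
  have h₀ : cos (a + b + c) = cos a := by linarith
  simp only [cos_add, sin_add, hb, hc] at h₀ h₅ h₆ h₇
  have of_sin_eq_zero (h0 : sin a = 0) : cos a = 1 ∨ cos a = -1 :=
    sq_eq_one_iff.1 (by simpa [h0] using hs)
  have sin_eq_zero_of (hx : x ^ 2 + 2 * x * cos a + 1 = 0) : sin a = 0 := by
    have : (x + cos a) ^ 2 + sin a ^ 2 = 0 := by linear_combination hx + hs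
    nlinarith [sq_nonneg (x + cos a), sq_nonneg (sin a)]
  have all_eq (h0 : sin a = 0) : cos b = cos a ∧ cos c = cos a ∧ sin b = sin a ∧ sin c = sin a ∧
      (cos a = 0 ∧ (sin a = 1 ∨ sin a = -1) ∨ sin a = 0 ∧ (cos a = 1 ∨ cos a = -1)) := by
    refine ⟨hb, hc, ?_, ?_, .inr ⟨h0, of_sin_eq_zero h0⟩⟩ <;> simp_all
  rcases hsb with hsb | hsb <;> rcases hsc with hsc | hsc <;> rw [hsb, hsc] at h₀ h₅ h₆ h₇
  · refine ⟨hb, hc, hsb, hsc, ?_⟩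
    have : cos a * sin a ^ 2 = 0 := by linear_combination (-1 / 4) * h₀ + cos a / 4 * hs
    rcases mul_eq_zero.1 this with h0 | h0
    · exact .inl ⟨h0, sq_eq_one_iff.1 (by simpa [h0] using hs)⟩
    · exact .inr ⟨pow_eq_zero_iff two_ne_zero |>.1 h0, of_sin_eq_zero (by simpa using h0)⟩
  · exact all_eq (sin_eq_zero_of (by linear_combination h₅ - 2 * hs))
  · exact all_eq (sin_eq_zero_of (by linear_combination h₆ - 2 * hs))
  · exact all_eq (sin_eq_zero_of (by linear_combination h₇ - 2 * hs))

theorem gyroid_degenerate_points (a b c : ℝ)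
    (ha : a ∈ Set.Ico 0 (2 * π)) (hb : b ∈ Set.Ico 0 (2 * π)) (hc : c ∈ Set.Ico 0 (2 * π)) :
    (∃ z : ℂ, (X - C z) ^ 2 ∣ (GyroidH a b c).charpoly) ↔
      (a, b, c) = (0, 0, 0) ∨ (a, b, c) = (π, π, π) ∨
      (a, b, c) = (π / 2, π / 2, π / 2) ∨ (a, b, c) = (3 * π / 2, 3 * π / 2, 3 * π / 2) := by
  have hπ := pi_pos
  have cos3 : cos (3 * π / 2) = 0 := by
    rw [show 3 * π / 2 = π / 2 + π by ring, cos_add_pi, cos_pi_div_two, neg_zero]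
  have sin3 : sin (3 * π / 2) = -1 := by
    rw [show 3 * π / 2 = π / 2 + π by ring, sin_add_pi, sin_pi_div_two]
  have exp3 : Complex.exp (Complex.I * (3 * π / 2 : ℝ)) = -Complex.I := by
    rw [mul_comm, Complex.exp_mul_I, ← Complex.ofReal_cos, ← Complex.ofReal_sin, cos3, sin3]
    simp
  constructor
  · rintro ⟨z, hz⟩
    obtain ⟨x, rfl, hx⟩ := exists_adjugate_eq_zero_of_sq_dvd_charpoly (isHermitian_gyroidH a b c) hz
    obtain ⟨hcb, hcc, hsb, hsc, h⟩ := cos_sin_cases_of_adjugate_gyroidH_eq_zero hx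
    obtain rfl : b = a := eq_of_cos_eq_of_sin_eq hb ha hcb hsb
    obtain rfl : c = b := eq_of_cos_eq_of_sin_eq hc hb hcc hsc
    have key {y : ℝ} (hy : y ∈ Set.Ico 0 (2 * π)) (hcos : cos c = cos y) (hsin : sin c = sin y) :
        (c, c, c) = (y, y, y) := by rw [eq_of_cos_eq_of_sin_eq hc hy hcos hsin]
    rcases h with ⟨h0, h1 | h1⟩ | ⟨h0, h1 | h1⟩
    · exact .inr <| .inr <| .inl <| key ⟨by linarith, by linarith⟩ (by simp [h0]) (by simp [h1])
    · exact .inr <| .inr <| .inr <| key ⟨by linarith, by linarith⟩ (by rw [h0, cos3])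
        (by rw [h1, sin3])
    · exact .inl <| key ⟨by linarith, by linarith⟩ (by simp [h1]) (by simp [h0])
    · exact .inr <| .inl <| key ⟨by linarith, by linarith⟩ (by simp [h1]) (by simp [h0])
  · rintro (h | h | h | h) <;> obtain ⟨rfl, rfl, rfl⟩ := by simpa only [Prod.mk.injEq] using h
    · refine ⟨-1, X ^ 2 - 2 * X - 3, ?_⟩
      rw [charpoly_gyroidH_diag (p := 1) (by simp)]
      norm_num [C_ofNat]
      ring
    · refine ⟨1, X ^ 2 + 2 * X - 3, ?_⟩
      rw [charpoly_gyroidH_diag (p := -1) (by rw [mul_comm, Complex.exp_pi_mul_I])]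
      norm_num [C_ofNat]
      ring
    · exact ⟨_, sq_dvd_charpoly_gyroidH_diag (p := Complex.I)
        (by rw [mul_comm]; simp [Complex.exp_pi_div_two_mul_I]) Complex.I_sq⟩
    · exact ⟨_, sq_dvd_charpoly_gyroidH_diag exp3 (by simp)⟩
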